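/- Assume 1 ≤ t ≤ d. Then the following equality of ideals of R holds: (I, f_1·I_L, f_2, …, f_t) : x_σ = (I, f_1·I_L, f_2, …, f_t) : f_1^{q+1} = (I_L, f_2, …, f_t). -/

import Mathlib

open MvPolynomial

set_option synthInstance.maxHeartbeats 1000000
set_option maxHeartbeats 1000000

noncomputable section

namespace SRWLP

variable (k : Type) [Field k]

/-- An (abstract) simplicial complex on the vertex set `Fin n`:
a collection of finite subsets (faces) closed under passing to subsets. -/
structure SC (n : ℕ) where
  faces : Finset (Finset (Fin n))
  down_closed : ∀ s ∈ faces, ∀ t ⊆ s, t ∈ faces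

variable {n : ℕ}

/-- `dimP D = dim D + 1`, i.e. the maximal cardinality of a face of `D`. -/
def dimP (D : SC n) : ℕ := D.faces.sup Finset.card

/-- The Stanley–Reisner ideal of `D`: the ideal generated by the squarefree
monomials corresponding to non-faces. -/
def srIdeal (D : SC n) : Ideal (MvPolynomial (Fin n) k) :=
  Ideal.span { p | ∃ s : Finset (Fin n), s ∉ D.faces ∧ p = ∏ i ∈ s, X i }

/-- `x_σ`, the product of the variables indexed by the face `σ`. -/
def xFace (σ : Finset (Fin n)) : MvPolynomial (Fin n) k := ∏ i ∈ σ, X i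

variable {ι : Type} [Fintype ι]

/-- The degree-`m` graded component of the standard graded algebra
`k[Xᵢ : i ∈ ι] ⧸ J`, as a `k`-submodule. -/
def qComp (J : Ideal (MvPolynomial ι k)) (m : ℕ) :
    Submodule k (MvPolynomial ι k ⧸ J) :=
  (homogeneousSubmodule ι k m).map (Ideal.Quotient.mkₐ k J).toLinearMap

/-- Graded components indexed by `ℤ` (zero in negative degrees). -/
def qCompZ (J : Ideal (MvPolynomial ι k)) (m : ℤ) :
    Submodule k (MvPolynomial ι k ⧸ J) :=
  if 0 ≤ m then qComp k J m.toNat else ⊥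

/-- The Hilbert function of `k[Xᵢ] ⧸ J`. -/
def HFq (J : Ideal (MvPolynomial ι k)) (m : ℕ) : ℕ := Module.finrank k (qComp k J m)

/-- The Hilbert function, with `ℤ` argument. -/
def HFZ (J : Ideal (MvPolynomial ι k)) (m : ℤ) : ℕ := Module.finrank k (qCompZ k J m)

/-- A property `P` of tuples `c : τ → k` holds *generically* (i.e. for all choices
in a suitable nonempty Zariski-open subset of the affine space `k^τ`) if there is a
nonzero polynomial `g` such that `P c` holds whenever `g` does not vanish at `c`. -/
def Generic (τ : Type) (P : (τ → k) → Prop) : Prop :=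
  ∃ g : MvPolynomial τ k, g ≠ 0 ∧ ∀ c : τ → k, eval c g ≠ 0 → P c

/-- The linear form with coefficient tuple `c`. -/
def linForm (c : ι → k) : MvPolynomial ι k := ∑ i, C (c i) * X i

/-- The ideal `J` together with the `d` linear forms encoded by `c`. -/
def redIdeal (J : Ideal (MvPolynomial ι k)) {d : ℕ} (c : Fin d × ι → k) :
    Ideal (MvPolynomial ι k) :=
  J ⊔ Ideal.span (Set.range fun j : Fin d => linForm k fun i => c (j, i))

/-- `depth (k[Xᵢ]⧸J) ≥ t` : there is a regular sequence of length `t` consisting of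
elements of the graded maximal ideal. -/
def depthGE (J : Ideal (MvPolynomial ι k)) (t : ℕ) : Prop :=
  ∃ rs : List (MvPolynomial ι k), rs.length = t ∧
    (∀ f ∈ rs, f ∈ Ideal.span (Set.range (X : ι → MvPolynomial ι k))) ∧
    RingTheory.Sequence.IsRegular (MvPolynomial ι k ⧸ J)
      (rs.map (Ideal.Quotient.mk J))

/-- `k[Xᵢ]⧸J` is Cohen–Macaulay of Krull dimension `d`. -/
def isCM (J : Ideal (MvPolynomial ι k)) (d : ℕ) : Prop :=
  ringKrullDim (MvPolynomial ι k ⧸ J) = (d : ℕ) ∧ depthGE k J d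

/-- The socle of `k[Xᵢ]⧸J` (the annihilator of the graded maximal ideal). -/
def socle (J : Ideal (MvPolynomial ι k)) : Submodule k (MvPolynomial ι k ⧸ J) :=
  ⨅ i : ι, LinearMap.ker (LinearMap.mulLeft k (Ideal.Quotient.mk J (X i)))

/-- `k[Xᵢ]⧸J` is Artinian Gorenstein: Artinian with one-dimensional socle. -/
def artGor (J : Ideal (MvPolynomial ι k)) : Prop :=
  IsArtinianRing (MvPolynomial ι k ⧸ J) ∧ Module.finrank k (socle k J) = 1

/-- `k[Xᵢ]⧸J` is Gorenstein of Krull dimension `d`: it is Cohen–Macaulay of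
dimension `d` and a general Artinian reduction is Artinian Gorenstein. -/
def isGor (J : Ideal (MvPolynomial ι k)) (d : ℕ) : Prop :=
  isCM k J d ∧ Generic k (Fin d × ι) fun c => artGor k (redIdeal k J c)

/-- Multiplication by `ω` from the degree-`m` component to the degree-`(m+1)`
component of `k[Xᵢ]⧸J` has maximal rank (is injective or surjective). -/
def mulMaxRank (J : Ideal (MvPolynomial ι k)) (ω : MvPolynomial ι k ⧸ J) (m : ℕ) : Prop :=
  (∀ x ∈ qComp k J m, ω * x = 0 → x = 0) ∨
  (∀ y ∈ qComp k J (m + 1), ∃ x ∈ qComp k J m, ω * x = y)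

/-- The Weak Lefschetz Property for the Artinian algebra `k[Xᵢ]⧸J`: for a general
linear form `ω`, multiplication `ω : (⧸J)ₘ → (⧸J)ₘ₊₁` has maximal rank for all `m`. -/
def artWLP (J : Ideal (MvPolynomial ι k)) : Prop :=
  Generic k ι fun c => ∀ m : ℕ,
    mulMaxRank k J (Ideal.Quotient.mk J (linForm k c)) m

/-- The Weak Lefschetz Property for `k[Xᵢ]⧸J` of Krull dimension `d ≥ 1`:
Cohen–Macaulay, and a general Artinian reduction has the WLP. -/
def hasWLP (J : Ideal (MvPolynomial ι k)) (d : ℕ) : Prop :=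
  isCM k J d ∧ Generic k (Fin d × ι) fun c => artWLP k (redIdeal k J c)

/-- The Strong Lefschetz Property for the Artinian algebra `k[Xᵢ]⧸J`. -/
def artSLP (J : Ideal (MvPolynomial ι k)) : Prop :=
  ∃ r : ℕ, qComp k J r ≠ ⊥ ∧ (∀ j : ℕ, r < j → qComp k J j = ⊥) ∧
    (∀ i ≤ r, HFq k J i = HFq k J (r - i)) ∧
    Generic k ι fun c => ∀ i : ℕ, 2 * i ≤ r →
      (∀ x ∈ qComp k J i,
          Ideal.Quotient.mk J (linForm k c) ^ (r - 2 * i) * x = 0 → x = 0) ∧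
      (∀ y ∈ qComp k J (r - i), ∃ x ∈ qComp k J i,
          Ideal.Quotient.mk J (linForm k c) ^ (r - 2 * i) * x = y)

/-- The Strong Lefschetz Property for `k[Xᵢ]⧸J` of Krull dimension `d ≥ 1`. -/
def hasSLP (J : Ideal (MvPolynomial ι k)) (d : ℕ) : Prop :=
  isCM k J d ∧ Generic k (Fin d × ι) fun c => artSLP k (redIdeal k J c)

/-- `D` is Gorenstein* over `k`: every element of the vertex set is a vertex,
`k[D]` is Gorenstein (of dimension `dim D + 1`), and for every vertex `i` there is a
face `τ` with `τ ∪ {i}` not a face. -/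
def gorStar (D : SC n) : Prop :=
  (∀ i : Fin n, {i} ∈ D.faces) ∧
  isGor k (srIdeal k D) (dimP D) ∧
  (∀ i : Fin n, ∃ τ ∈ D.faces, insert i τ ∉ D.faces)

/-! `R[T]` is modelled as the polynomial ring in `n+1` variables, the last
variable playing the role of `T`. -/

/-- The inclusion `R = k[x₁,…,xₙ] → R[T] = k[x₁,…,xₙ,T]`. -/
def toT : MvPolynomial (Fin n) k →ₐ[k] MvPolynomial (Fin (n + 1)) k :=
  rename Fin.castSucc

/-- The variable `T` of `R[T]`. -/
def Tv (n : ℕ) : MvPolynomial (Fin (n + 1)) k := X (Fin.last n)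

/-- Extension of an ideal of `R` to `R[T]`. -/
def extI (J : Ideal (MvPolynomial (Fin n) k)) : Ideal (MvPolynomial (Fin (n + 1)) k) :=
  Ideal.map (toT k) J

/-- The ideal `T·J` of `R[T]`, for an ideal `J` of `R`. -/
def TmulI (J : Ideal (MvPolynomial (Fin n) k)) : Ideal (MvPolynomial (Fin (n + 1)) k) :=
  Ideal.span ((fun f => Tv k n * toT k f) '' (J : Set (MvPolynomial (Fin n) k)))

/-- `I_L = (I_D : x_σ)`, the Stanley–Reisner ideal of the link of `σ` in `D`
(extended to `R`). -/
def linkIdeal (D : SC n) (σ : Finset (Fin n)) : Ideal (MvPolynomial (Fin n) k) :=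
  Submodule.colon (srIdeal k D) (Ideal.span {xFace k σ})

/-- `J_st = (I, x_σ, T·I_L) ⊂ R[T]`, the Stanley–Reisner ideal of the stellar
subdivision `D_σ`. -/
def Jst (D : SC n) (σ : Finset (Fin n)) : Ideal (MvPolynomial (Fin (n + 1)) k) :=
  extI k (srIdeal k D) ⊔ Ideal.span {toT k (xFace k σ)} ⊔ TmulI k (linkIdeal k D σ)

/-- `I_C = (I, T^{q+1}, T·I_L) ⊂ R[T]`. -/
def IC (D : SC n) (σ : Finset (Fin n)) (q : ℕ) : Ideal (MvPolynomial (Fin (n + 1)) k) :=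
  extI k (srIdeal k D) ⊔ Ideal.span {Tv k n ^ (q + 1)} ⊔ TmulI k (linkIdeal k D σ)

/-- `I_G = (I, T^{q+1} - x_σ, T·I_L) ⊂ R[T]`. -/
def IG (D : SC n) (σ : Finset (Fin n)) (q : ℕ) : Ideal (MvPolynomial (Fin (n + 1)) k) :=
  extI k (srIdeal k D) ⊔ Ideal.span {Tv k n ^ (q + 1) - toT k (xFace k σ)} ⊔
    TmulI k (linkIdeal k D σ)

/-- The ideal of `R[T]` generated by `d` general linear forms of `R`
(involving only the `x`-variables). -/
def xForms {d : ℕ} (c : Fin d × Fin n → k) : Ideal (MvPolynomial (Fin (n + 1)) k) :=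
  Ideal.span (Set.range fun j : Fin d => toT k (linForm k fun i => c (j, i)))

/-- Property `M_{q,p₁}` for the Artinian algebra `B = R⧸J_B`: for a general linear
form `ω`, multiplication by `ω^q : B_{p₁-q} → B_{p₁}` is injective. -/
def propM (JB : Ideal (MvPolynomial (Fin n) k)) (q p₁ : ℕ) : Prop :=
  Generic k (Fin n) fun c => ∀ x ∈ qCompZ k JB ((p₁ : ℤ) - (q : ℤ)),
    Ideal.Quotient.mk JB (linForm k c) ^ q * x = 0 → x = 0


/-- The ideal `f·J = ({f·g : g ∈ J})` of `R`. -/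
def mulIdeal {n : ℕ} (f : MvPolynomial (Fin n) k) (J : Ideal (MvPolynomial (Fin n) k)) :
    Ideal (MvPolynomial (Fin n) k) :=
  Ideal.span ((fun g => f * g) '' (J : Set (MvPolynomial (Fin n) k)))

section RegularSequences

open scoped Pointwise

variable {R : Type*} [CommRing R]

/-- `rs` is a weakly regular sequence on `R ⧸ J`, phrased inside `R`. -/
def Reg : Ideal R → List R → Prop
  | _, [] => True
  | J, r :: rs => (∀ g, r * g ∈ J → g ∈ J) ∧ Reg (J ⊔ Ideal.span {r}) rs

theorem reg_append (J : Ideal R) (L L' : List R) :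
    Reg J (L ++ L') ↔ Reg J L ∧ Reg (J ⊔ Ideal.ofList L) L' := by
  induction L generalizing J with
  | nil => simp [Reg]
  | cons r L ih => simp [Reg, ih, and_assoc, sup_assoc]

theorem reg_of_isWeaklyRegular (J : Ideal R) (rs : List R)
    (h : RingTheory.Sequence.IsWeaklyRegular (R ⧸ J) rs) : Reg J rs := by
  induction rs generalizing J with
  | nil => trivial
  | cons r rs ih =>
    rw [RingTheory.Sequence.isWeaklyRegular_cons_iff] at h
    refine ⟨fun g hg => ?_, ih _ ?_⟩
    · have := h.1 (a₁ := Ideal.Quotient.mk J g) (a₂ := 0) (by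
        simp only [smul_zero]
        rw [← Ideal.Quotient.eq_zero_iff_mem] at hg
        rw [← hg]; rfl)
      exact Ideal.Quotient.eq_zero_iff_mem.mp this
    · have e : r • (⊤ : Submodule R (R ⧸ J)) =
          Submodule.map (Submodule.mkQ J) (Ideal.span {r}) := by
        ext y
        simp only [Submodule.mem_smul_pointwise_iff_exists, Submodule.mem_map,
          Ideal.mem_span_singleton']
        constructor
        · rintro ⟨b, -, rfl⟩
          obtain ⟨b, rfl⟩ := Submodule.mkQ_surjective J b
          exact ⟨b * r, ⟨b, rfl⟩, by rw [mul_comm, ← smul_eq_mul, map_smul]⟩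
        · rintro ⟨_, ⟨a, rfl⟩, rfl⟩
          exact ⟨Submodule.mkQ J a, trivial, by rw [mul_comm, ← smul_eq_mul, map_smul]⟩
      exact (((Submodule.quotEquivOfEq _ _ e).trans
        (Submodule.quotientQuotientEquivQuotientSup J (Ideal.span {r}))).isWeaklyRegular_congr
          rs).mp h.2

theorem ringKrullDim_add_length_le (J : Ideal R) (L : List R) (h : Reg J L) :
    ringKrullDim (R ⧸ (J ⊔ Ideal.ofList L)) + L.length ≤ ringKrullDim (R ⧸ J) := by
  induction L generalizing J with
  | nil =>
    rw [Ideal.ofList_nil, sup_bot_eq]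
    simp
  | cons r L ih =>
    have h1 := ih _ h.2
    have h2 : Ideal.Quotient.mk J r ∈ nonZeroDivisors (R ⧸ J) := by
      rw [mem_nonZeroDivisors_iff_right]
      intro x hx
      obtain ⟨x, rfl⟩ := Ideal.Quotient.mk_surjective x
      rw [← map_mul, Ideal.Quotient.eq_zero_iff_mem, mul_comm] at hx
      exact Ideal.Quotient.eq_zero_iff_mem.mpr (h.1 x hx)
    have h3 := ringKrullDim_quotient_succ_le_of_nonZeroDivisor h2
    have h4 : ringKrullDim ((R ⧸ J) ⧸ Ideal.span {Ideal.Quotient.mk J r}) =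
        ringKrullDim (R ⧸ (J ⊔ Ideal.span {r})) := by
      have := ringKrullDim_eq_of_ringEquiv (DoubleQuot.quotQuotEquivQuotSup J (Ideal.span {r}))
      rwa [Ideal.map_span, Set.image_singleton] at this
    rw [h4] at h3
    rw [Ideal.ofList_cons, ← sup_assoc]
    refine le_trans ?_ h3
    rw [List.length_cons, Nat.cast_add, Nat.cast_one, ← add_assoc]
    gcongr

/-- The ideal `m` contains no annihilator of a nonzero element of `R ⧸ J`. -/
def NoSocle (m J : Ideal R) : Prop := ∀ u, (∀ x ∈ m, x * u ∈ J) → u ∈ J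

theorem noSocle_of_nzd {m J : Ideal R} {x : R} (hx : x ∈ m) (h : ∀ g, x * g ∈ J → g ∈ J) :
    NoSocle m J := fun u hu => h u (hu x hx)

theorem mem_sup_span_singleton_iff (J : Ideal R) (r a : R) :
    a ∈ J ⊔ Ideal.span {r} ↔ ∃ b, a - r * b ∈ J := by
  rw [sup_comm, Ideal.mem_span_singleton_sup]
  constructor
  · rintro ⟨b, c, hc, rfl⟩
    exact ⟨b, by convert hc using 1; ring⟩
  · rintro ⟨b, hb⟩
    exact ⟨b, _, hb, by ring⟩

theorem noSocle_sup_swap {m J : Ideal R} {x y : R} (hx : x ∈ m)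
    (hxJ : ∀ g, x * g ∈ J → g ∈ J) (hyJ : ∀ g, y * g ∈ J → g ∈ J)
    (h : NoSocle m (J ⊔ Ideal.span {x})) : NoSocle m (J ⊔ Ideal.span {y}) := by
  intro u hu
  simp only [NoSocle, mem_sup_span_singleton_iff] at *
  obtain ⟨v, hv⟩ := hu x hx
  obtain ⟨a, ha⟩ := h v fun z hz => by
    obtain ⟨w, hw⟩ := hu z hz
    refine ⟨w, hyJ _ ?_⟩
    have := sub_mem (J.mul_mem_left x hw) (J.mul_mem_left z hv)
    convert this using 1
    ring
  refine ⟨a, hxJ _ ?_⟩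
  convert add_mem hv (J.mul_mem_left y ha) using 1
  ring

theorem nzd_sup_swap {J : Ideal R} {x z : R}
    (hx : ∀ g, x * g ∈ J → g ∈ J)
    (hzx : ∀ g, z * g ∈ J ⊔ Ideal.span {x} → g ∈ J ⊔ Ideal.span {x}) :
    ∀ g, x * g ∈ J ⊔ Ideal.span {z} → g ∈ J ⊔ Ideal.span {z} := by
  simp only [mem_sup_span_singleton_iff] at *
  rintro g ⟨w, hw⟩
  obtain ⟨v, hv⟩ := hzx w ⟨g, by rw [← neg_mem_iff]; convert hw using 1; ring⟩
  refine ⟨v, hx _ ?_⟩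
  convert add_mem hw (J.mul_mem_left z hv) using 1
  ring

/-- Exchange: if `R ⧸ J` has a regular sequence of length `e + 1` in `m` and `x ∈ m` is
a nonzerodivisor on `R ⧸ J`, then `R ⧸ (J, x)` has a regular sequence of length `e` in `m`. -/
theorem exists_reg_sup_of_reg {m : Ideal R}
    (hm : ∀ J₁ J₂ J₃ : Ideal R, NoSocle m J₁ → NoSocle m J₂ → NoSocle m J₃ →
      ∃ z ∈ m, (∀ g, z * g ∈ J₁ → g ∈ J₁) ∧ (∀ g, z * g ∈ J₂ → g ∈ J₂) ∧
        ∀ g, z * g ∈ J₃ → g ∈ J₃) (e : ℕ) :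
    ∀ (J : Ideal R) (x : R) (rs : List R), x ∈ m → (∀ g, x * g ∈ J → g ∈ J) →
      rs.length = e + 1 → (∀ r ∈ rs, r ∈ m) → Reg J rs →
      ∃ rs' : List R, rs'.length = e ∧ (∀ r ∈ rs', r ∈ m) ∧ Reg (J ⊔ Ideal.span {x}) rs' := by
  induction e with
  | zero => exact fun J x rs _ _ _ _ _ => ⟨[], rfl, by simp, trivial⟩
  | succ e ih =>
    intro J x rs hx hxJ hlen hrs hreg
    obtain _ | ⟨y, _ | ⟨y', rs⟩⟩ := rs
    · simp at hlen
    · simp at hlen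
    have hy : y ∈ m := hrs y (by simp)
    have hs : NoSocle m (J ⊔ Ideal.span {y}) := noSocle_of_nzd (hrs y' (by simp)) hreg.2.1
    obtain ⟨z, hz, hzJ, hzy, hzx⟩ := hm J _ _ (noSocle_of_nzd hx hxJ) hs
      (noSocle_sup_swap hy hreg.1 hxJ hs)
    obtain ⟨L, hL, hLm, hLr⟩ := ih (J ⊔ Ideal.span {y}) z (y' :: rs) hz hzy (by simpa using hlen)
      (fun r hr => hrs r (List.mem_cons_of_mem _ hr)) hreg.2
    obtain ⟨L', hL', hLm', hLr'⟩ := ih (J ⊔ Ideal.span {z}) x (y :: L) hx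
      (nzd_sup_swap hxJ hzx) (by simp [hL]) (by simpa using ⟨hy, hLm⟩)
      ⟨nzd_sup_swap hreg.1 hzy, by rwa [sup_right_comm]⟩
    exact ⟨z :: L', by simp [hL'], by simpa using ⟨hz, hLm'⟩, hzx, by rwa [sup_right_comm]⟩

end RegularSequences

section LinearForms

/-- The homogeneous maximal ideal. -/
abbrev irrel (n : ℕ) : Ideal (MvPolynomial (Fin n) k) := Ideal.span (Set.range X)

variable {k}

theorem linForm_mem_irrel (c : Fin n → k) : linForm k c ∈ irrel k n :=
  Ideal.sum_mem _ fun i _ => Ideal.mul_mem_left _ _ (Ideal.subset_span ⟨i, rfl⟩)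

theorem linForm_isHomogeneous (c : Fin n → k) : (linForm k c).IsHomogeneous 1 := by
  refine IsHomogeneous.sum _ _ _ fun i _ => ?_
  simpa using (isHomogeneous_C (Fin n) (c i)).mul (isHomogeneous_X k i)

theorem linForm_single (i : Fin n) : linForm k (Pi.single i 1) = X i := by
  simp [linForm, Pi.single_apply]

/-- The coefficient-to-form map as a linear map. -/
def linFormₗ (k : Type) [Field k] (n : ℕ) : (Fin n → k) →ₗ[k] MvPolynomial (Fin n) k where
  toFun := linForm k
  map_add' c c' := by simp [linForm, add_mul, Finset.sum_add_distrib]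
  map_smul' a c := by simp [linForm, MvPolynomial.smul_eq_C_mul, Finset.mul_sum, mul_assoc]

theorem exists_linForm_nzd [Infinite k] (s : Finset (Ideal (MvPolynomial (Fin n) k)))
    (hs : ∀ J ∈ s, NoSocle (irrel k n) J) :
    ∃ c : Fin n → k, ∀ J ∈ s, ∀ g, linForm k c * g ∈ J → g ∈ J := by
  classical
  let A (J : Ideal (MvPolynomial (Fin n) k)) : Finset (Ideal (MvPolynomial (Fin n) k)) :=
    (associatedPrimes.finite (MvPolynomial (Fin n) k) (MvPolynomial (Fin n) k ⧸ J)).toFinset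
  let V (p : Ideal (MvPolynomial (Fin n) k)) : Subspace k (Fin n → k) :=
    (p.restrictScalars k).comap (linFormₗ k n)
  have key : (⊤ : Subspace k (Fin n → k)) ∉ (s.biUnion A).image V := by
    simp only [Finset.mem_image, Finset.mem_biUnion, not_exists, not_and]
    rintro p ⟨J, hJ, hp⟩ htop
    have hp : IsAssociatedPrime p (MvPolynomial (Fin n) k ⧸ J) :=
      AssociatedPrimes.mem_iff.mp (by simpa [A] using hp)
    rw [isAssociatedPrime_iff] at hp
    obtain ⟨hprime, u, hu⟩ := hp
    obtain ⟨u, rfl⟩ := Ideal.Quotient.mk_surjective u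
    have hle : irrel k n ≤ p := by
      rw [Ideal.span_le]
      rintro _ ⟨i, rfl⟩
      have : Pi.single i 1 ∈ V p := htop ▸ trivial
      rw [← linForm_single]
      exact this
    have mem (r) : r ∈ p ↔ r * u ∈ J := by
      rw [hu, Submodule.mem_colon_singleton, Submodule.mem_bot, ← Ideal.Quotient.eq_zero_iff_mem]
      rfl
    have huJ : u ∈ J := hs J hJ u fun x hx => (mem x).mp (hle hx)
    exact hprime.ne_top ((Ideal.eq_top_iff_one _).mpr ((mem 1).mpr (by simpa using huJ)))
  obtain ⟨c, hc⟩ : ∃ c, c ∉ ⋃ p ∈ (s.biUnion A).image V, (p : Set (Fin n → k)) := by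
    by_contra! h
    exact Subspace.biUnion_ne_univ_of_top_notMem key (Set.eq_univ_of_forall h)
  refine ⟨c, fun J hJ g hg => ?_⟩
  by_contra hgJ
  have h1 : linForm k c ∈ ⋃ p ∈ associatedPrimes (MvPolynomial (Fin n) k)
      (MvPolynomial (Fin n) k ⧸ J), (p : Set (MvPolynomial (Fin n) k)) := by
    rw [biUnion_associatedPrimes_eq_zero_divisors]
    refine ⟨Ideal.Quotient.mk J g, fun h => hgJ (Ideal.Quotient.eq_zero_iff_mem.mp h), ?_⟩
    exact Ideal.Quotient.eq_zero_iff_mem.mpr hg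
  simp only [Set.mem_iUnion] at h1 hc
  obtain ⟨p, hp, hcp⟩ := h1
  exact hc ⟨V p, Finset.mem_image_of_mem _ (Finset.mem_biUnion.mpr ⟨J, hJ, by simpa [A] using hp⟩),
    hcp⟩

theorem exists_linear_reg [Infinite k] (e : ℕ) :
    ∀ (J : Ideal (MvPolynomial (Fin n) k)) (rs : List (MvPolynomial (Fin n) k)),
      rs.length = e → (∀ r ∈ rs, r ∈ irrel k n) → Reg J rs →
      ∃ l : List (Fin n → k), l.length = e ∧ Reg J (l.map (linForm k)) := by
  classical
  induction e with
  | zero => exact fun J rs _ _ _ => ⟨[], rfl, trivial⟩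
  | succ e ih =>
    intro J rs hlen hrs hreg
    obtain _ | ⟨y, rs⟩ := rs
    · simp at hlen
    obtain ⟨c, hc⟩ := exists_linForm_nzd {J} (by
      simpa using noSocle_of_nzd (hrs y (by simp)) hreg.1)
    have hc := hc J (by simp)
    obtain ⟨L, hL, hLm, hLr⟩ := exists_reg_sup_of_reg (m := irrel k n) (fun J₁ J₂ J₃ h₁ h₂ h₃ => by
      obtain ⟨z, hz⟩ := exists_linForm_nzd {J₁, J₂, J₃} (by simp [h₁, h₂, h₃])
      exact ⟨_, linForm_mem_irrel z, hz _ (by simp), hz _ (by simp), hz _ (by simp)⟩) e J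
      (linForm k c) (y :: rs) (linForm_mem_irrel c) hc hlen hrs hreg
    obtain ⟨l, hl, hlr⟩ := ih _ L hL hLm hLr
    exact ⟨c :: l, by simp [hl], hc, hlr⟩

end LinearForms

section HilbertFunction

variable {k}

theorem homogeneousComponent_mul_of_isHomogeneous_one {θ : MvPolynomial (Fin n) k}
    (hθ : θ.IsHomogeneous 1) (b : MvPolynomial (Fin n) k) (m : ℕ) :
    homogeneousComponent (m + 1) (θ * b) = θ * homogeneousComponent m b := by
  have h (i : ℕ) : homogeneousComponent (m + 1) (θ * homogeneousComponent i b) =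
      if m = i then θ * homogeneousComponent m b else 0 := by
    have hi : (θ * homogeneousComponent i b).IsHomogeneous (i + 1) := by
      rw [add_comm]
      exact hθ.mul (homogeneousComponent_isHomogeneous i b)
    rw [homogeneousComponent_of_mem hi]
    by_cases hmi : m = i
    · subst hmi; simp
    · rw [if_neg (by omega), if_neg hmi]
  conv_lhs => rw [← sum_homogeneousComponent b, Finset.mul_sum, map_sum]
  simp only [h, Finset.sum_ite_eq, Finset.mem_range]
  split_ifs with hm
  · rfl
  · rw [homogeneousComponent_eq_zero _ _ (by omega), mul_zero]

theorem homogeneousComponent_zero_mul_of_isHomogeneous_one {θ : MvPolynomial (Fin n) k}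
    (hθ : θ.IsHomogeneous 1) (b : MvPolynomial (Fin n) k) :
    homogeneousComponent 0 (θ * b) = 0 := by
  conv_lhs => rw [← sum_homogeneousComponent b, Finset.mul_sum, map_sum]
  refine Finset.sum_eq_zero fun i _ => ?_
  rw [homogeneousComponent_of_mem (hθ.mul (homogeneousComponent_isHomogeneous i b)),
    if_neg (by omega)]

/-- `J` contains the homogeneous components of its elements. -/
def HomIdeal (J : Ideal (MvPolynomial (Fin n) k)) : Prop :=
  ∀ a ∈ J, ∀ m, homogeneousComponent m a ∈ J

theorem HomIdeal.sup_span {J : Ideal (MvPolynomial (Fin n) k)} (hJ : HomIdeal J)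
    {θ : MvPolynomial (Fin n) k} (hθ : θ.IsHomogeneous 1) : HomIdeal (J ⊔ Ideal.span {θ}) := by
  intro a ha m
  rw [mem_sup_span_singleton_iff] at ha ⊢
  obtain ⟨b, hb⟩ := ha
  cases m with
  | zero =>
    refine ⟨0, ?_⟩
    have := hJ _ hb 0
    rw [mul_zero, sub_zero]
    rwa [map_sub, homogeneousComponent_zero_mul_of_isHomogeneous_one hθ, sub_zero] at this
  | succ m =>
    refine ⟨homogeneousComponent m b, ?_⟩
    simpa [homogeneousComponent_mul_of_isHomogeneous_one hθ] using hJ _ hb (m + 1)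

theorem HomIdeal.mem_of_forall {J : Ideal (MvPolynomial (Fin n) k)} {a : MvPolynomial (Fin n) k}
    (h : ∀ m, homogeneousComponent m a ∈ J) : a ∈ J := by
  rw [← sum_homogeneousComponent a]
  exact sum_mem fun i _ => h i

instance (m : ℕ) : FiniteDimensional k (homogeneousSubmodule (Fin n) k m) :=
  Module.Finite.iff_fg.mpr (homogeneousSubmodule_fg (Fin n) k m)

/-- The degree-`m` part of an ideal. -/
def degPart (J : Ideal (MvPolynomial (Fin n) k)) (m : ℕ) : Submodule k (MvPolynomial (Fin n) k) :=
  homogeneousSubmodule (Fin n) k m ⊓ J.restrictScalars k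

instance (J : Ideal (MvPolynomial (Fin n) k)) (m : ℕ) : FiniteDimensional k (degPart J m) :=
  Submodule.finiteDimensional_of_le inf_le_left

/-- The Hilbert function of `R ⧸ J`, with values in `ℤ`. -/
def hilb (J : Ideal (MvPolynomial (Fin n) k)) (m : ℕ) : ℤ :=
  Module.finrank k (homogeneousSubmodule (Fin n) k m) - Module.finrank k (degPart J m)

/-- The elements of degree `m` multiplied into `J` by `θ`. -/
def degColon (θ : MvPolynomial (Fin n) k) (J : Ideal (MvPolynomial (Fin n) k)) (m : ℕ) :
    Submodule k (MvPolynomial (Fin n) k) :=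
  homogeneousSubmodule (Fin n) k m ⊓ (J.restrictScalars k).comap (LinearMap.mulLeft k θ)

instance (θ : MvPolynomial (Fin n) k) (J : Ideal (MvPolynomial (Fin n) k)) (m : ℕ) :
    FiniteDimensional k (degColon θ J m) :=
  Submodule.finiteDimensional_of_le inf_le_left

theorem degPart_le_degColon (θ : MvPolynomial (Fin n) k) (J : Ideal (MvPolynomial (Fin n) k))
    (m : ℕ) : degPart J m ≤ degColon θ J m :=
  fun _ ha => ⟨ha.1, J.mul_mem_left θ ha.2⟩

theorem finrank_degPart_sup_span {J : Ideal (MvPolynomial (Fin n) k)} (hJ : HomIdeal J)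
    {θ : MvPolynomial (Fin n) k} (hθ : θ.IsHomogeneous 1) (m : ℕ) :
    Module.finrank k (degPart (J ⊔ Ideal.span {θ}) (m + 1)) + Module.finrank k (degColon θ J m) =
      Module.finrank k (homogeneousSubmodule (Fin n) k m) +
        Module.finrank k (degPart J (m + 1)) := by
  obtain rfl | h0 := eq_or_ne θ 0
  · have h1 : J ⊔ Ideal.span {0} = J := by simp
    have h2 : degColon 0 J m = homogeneousSubmodule (Fin n) k m :=
      inf_eq_left.mpr fun a _ => by simp
    rw [h1, h2, add_comm]
  have hinj : Function.Injective (LinearMap.mulLeft k θ) := mul_right_injective₀ h0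
  have hfr (p : Submodule k (MvPolynomial (Fin n) k)) :
      Module.finrank k (p.map (LinearMap.mulLeft k θ)) = Module.finrank k p :=
    (Submodule.equivMapOfInjective _ hinj p).finrank_eq.symm
  have hsup : (homogeneousSubmodule (Fin n) k m).map (LinearMap.mulLeft k θ) ⊔ degPart J (m + 1) =
      degPart (J ⊔ Ideal.span {θ}) (m + 1) := by
    apply le_antisymm
    · refine sup_le ?_ fun a ha => ⟨ha.1, Ideal.mem_sup_left ha.2⟩
      rintro _ ⟨g, hg, rfl⟩
      refine ⟨?_, Ideal.mem_sup_right (Ideal.mul_mem_right _ _ (Ideal.mem_span_singleton_self θ))⟩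
      have := hθ.mul hg
      rwa [add_comm] at this
    · rintro a ⟨ha, haJ⟩
      obtain ⟨b, hb⟩ := (mem_sup_span_singleton_iff _ _ _).mp haJ
      have hb := hJ _ hb (m + 1)
      rw [map_sub, homogeneousComponent_eq_self ha,
        homogeneousComponent_mul_of_isHomogeneous_one hθ] at hb
      have hc : (homogeneousComponent m b).IsHomogeneous m := homogeneousComponent_isHomogeneous m b
      have hc' : (θ * homogeneousComponent m b).IsHomogeneous (m + 1) := by
        rw [add_comm]; exact hθ.mul hc
      refine Submodule.mem_sup.mpr ⟨θ * homogeneousComponent m b, ⟨_, hc, rfl⟩, _,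
        ⟨Submodule.sub_mem _ ha hc', hb⟩, by ring⟩
  have hinf : (homogeneousSubmodule (Fin n) k m).map (LinearMap.mulLeft k θ) ⊓ degPart J (m + 1) =
      (degColon θ J m).map (LinearMap.mulLeft k θ) := by
    apply le_antisymm
    · rintro _ ⟨⟨g, hg, rfl⟩, h⟩
      exact ⟨g, ⟨hg, h.2⟩, rfl⟩
    · rintro _ ⟨g, hg, rfl⟩
      refine ⟨⟨g, hg.1, rfl⟩, ?_, hg.2⟩
      have := hθ.mul hg.1
      rwa [add_comm] at this
  have : FiniteDimensional k
      ((homogeneousSubmodule (Fin n) k m).map (LinearMap.mulLeft k θ)) := inferInstance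
  have := Submodule.finrank_sup_add_finrank_inf_eq
    ((homogeneousSubmodule (Fin n) k m).map (LinearMap.mulLeft k θ)) (degPart J (m + 1))
  rwa [hsup, hinf, hfr, hfr] at this

theorem hilb_sup_span_succ {J : Ideal (MvPolynomial (Fin n) k)} (hJ : HomIdeal J)
    {θ : MvPolynomial (Fin n) k} (hθ : θ.IsHomogeneous 1) (m : ℕ) :
    hilb (J ⊔ Ideal.span {θ}) (m + 1) = hilb J (m + 1) -
      Module.finrank k (homogeneousSubmodule (Fin n) k m) + Module.finrank k (degColon θ J m) := by
  have := finrank_degPart_sup_span hJ hθ m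
  simp only [hilb]
  omega

theorem hilb_sup_span_zero {J : Ideal (MvPolynomial (Fin n) k)} (hJ : HomIdeal J)
    {θ : MvPolynomial (Fin n) k} (hθ : θ.IsHomogeneous 1) :
    hilb (J ⊔ Ideal.span {θ}) 0 = hilb J 0 := by
  have : degPart (J ⊔ Ideal.span {θ}) 0 = degPart J 0 := by
    apply le_antisymm
    · rintro a ⟨ha, haJ⟩
      obtain ⟨b, hb⟩ := (mem_sup_span_singleton_iff _ _ _).mp haJ
      have hb := hJ _ hb 0
      rw [map_sub, homogeneousComponent_eq_self ha,
        homogeneousComponent_zero_mul_of_isHomogeneous_one hθ, sub_zero] at hb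
      exact ⟨ha, hb⟩
    · exact fun a ha => ⟨ha.1, Ideal.mem_sup_left ha.2⟩
  rw [hilb, hilb, this]

/-- Partial sums. -/
def psum (u : ℕ → ℤ) (m : ℕ) : ℤ := ∑ i ∈ Finset.range (m + 1), u i

theorem psum_mono {u v : ℕ → ℤ} (h : u ≤ v) : psum u ≤ psum v :=
  fun _ => Finset.sum_le_sum fun i _ => h i

theorem psum_injective : Function.Injective psum := by
  intro u v h
  ext m
  cases m with
  | zero => simpa [psum] using congrFun h 0
  | succ m =>
    have h1 := congrFun h m
    have h2 := congrFun h (m + 1)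
    simp only [psum] at h1 h2
    rw [Finset.sum_range_succ, Finset.sum_range_succ _ (m + 1), h1] at h2
    exact add_left_cancel h2

theorem hilb_sub_le {J : Ideal (MvPolynomial (Fin n) k)} (hJ : HomIdeal J)
    {θ : MvPolynomial (Fin n) k} (hθ : θ.IsHomogeneous 1) (m : ℕ) :
    hilb J (m + 1) - hilb J m ≤ hilb (J ⊔ Ideal.span {θ}) (m + 1) := by
  rw [hilb_sup_span_succ hJ hθ]
  have := Submodule.finrank_mono (degPart_le_degColon θ J m)
  simp only [hilb]
  omega

theorem hilb_le_psum {J : Ideal (MvPolynomial (Fin n) k)} (hJ : HomIdeal J)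
    {θ : MvPolynomial (Fin n) k} (hθ : θ.IsHomogeneous 1) :
    hilb J ≤ psum (hilb (J ⊔ Ideal.span {θ})) := by
  intro m
  induction m with
  | zero => simp [psum, hilb_sup_span_zero hJ hθ]
  | succ m ih =>
    have := hilb_sub_le hJ hθ m
    simp only [psum] at ih ⊢
    rw [Finset.sum_range_succ]
    omega

theorem hilb_eq_psum_iff {J : Ideal (MvPolynomial (Fin n) k)} (hJ : HomIdeal J)
    {θ : MvPolynomial (Fin n) k} (hθ : θ.IsHomogeneous 1) :
    hilb J = psum (hilb (J ⊔ Ideal.span {θ})) ↔ ∀ g, θ * g ∈ J → g ∈ J := by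
  constructor
  · intro h g hg
    refine HomIdeal.mem_of_forall fun m => ?_
    have h1 := congrFun h m
    have h2 := congrFun h (m + 1)
    simp only [psum] at h1 h2
    rw [Finset.sum_range_succ _ (m + 1), ← h1, hilb_sup_span_succ hJ hθ] at h2
    have h3 : degPart J m = degColon θ J m := by
      refine Submodule.eq_of_le_of_finrank_eq (degPart_le_degColon θ J m) ?_
      simp only [hilb] at h2
      omega
    have h4 : homogeneousComponent m g ∈ degColon θ J m := by
      refine ⟨homogeneousComponent_isHomogeneous m g, ?_⟩
      have := hJ _ hg (m + 1)
      rwa [homogeneousComponent_mul_of_isHomogeneous_one hθ] at this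
    rw [← h3] at h4
    exact h4.2
  · intro h
    ext m
    induction m with
    | zero => simp [psum, hilb_sup_span_zero hJ hθ]
    | succ m ih =>
      have h3 : degColon θ J m = degPart J m :=
        le_antisymm (fun a ha => ⟨ha.1, h a ha.2⟩) (degPart_le_degColon θ J m)
      simp only [psum] at ih ⊢
      rw [Finset.sum_range_succ, ← ih, hilb_sup_span_succ hJ hθ, h3]
      simp only [hilb]
      ring

theorem HomIdeal.sup_ofList {J : Ideal (MvPolynomial (Fin n) k)} (hJ : HomIdeal J)
    (l : List (Fin n → k)) : HomIdeal (J ⊔ Ideal.ofList (l.map (linForm k))) := by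
  induction l generalizing J with
  | nil => simpa using hJ
  | cons c l ih =>
    rw [List.map_cons, Ideal.ofList_cons, ← sup_assoc]
    exact ih (hJ.sup_span (linForm_isHomogeneous c))

theorem psum_iterate_mono {u v : ℕ → ℤ} (e : ℕ) (h : u ≤ v) : psum^[e] u ≤ psum^[e] v :=
  (show Monotone psum from fun _ _ => psum_mono).iterate e h

theorem hilb_le_iterate {J : Ideal (MvPolynomial (Fin n) k)} (hJ : HomIdeal J)
    (l : List (Fin n → k)) :
    hilb J ≤ psum^[l.length] (hilb (J ⊔ Ideal.ofList (l.map (linForm k)))) := by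
  induction l generalizing J with
  | nil => simp
  | cons c l ih =>
    rw [List.map_cons, Ideal.ofList_cons, ← sup_assoc, List.length_cons,
      Function.iterate_succ_apply']
    exact (hilb_le_psum hJ (linForm_isHomogeneous c)).trans
      (psum_mono (ih (hJ.sup_span (linForm_isHomogeneous c))))

theorem hilb_eq_iterate_iff {J : Ideal (MvPolynomial (Fin n) k)} (hJ : HomIdeal J)
    (l : List (Fin n → k)) :
    hilb J = psum^[l.length] (hilb (J ⊔ Ideal.ofList (l.map (linForm k)))) ↔
      Reg J (l.map (linForm k)) := by
  induction l generalizing J with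
  | nil => simp [Reg]
  | cons c l ih =>
    have hθ := linForm_isHomogeneous (k := k) c
    have ih := ih (hJ.sup_span hθ)
    have hle := psum_mono (hilb_le_iterate (hJ.sup_span hθ) l)
    rw [List.map_cons, Ideal.ofList_cons, ← sup_assoc, List.length_cons,
      Function.iterate_succ_apply', Reg, ← ih, ← hilb_eq_psum_iff hJ hθ]
    constructor
    · intro h
      have h1 := (hilb_le_psum hJ hθ).antisymm (hle.trans h.ge)
      exact ⟨h1, psum_injective (h1.symm.trans h)⟩
    · rintro ⟨h1, h2⟩
      rw [← h2, ← h1]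

/-- A sequence of linear forms whose quotient has Hilbert function bounded above by that of a
regular sequence of linear forms of the same length is regular. -/
theorem reg_of_hilb_le {J : Ideal (MvPolynomial (Fin n) k)} (hJ : HomIdeal J)
    {l l' : List (Fin n → k)} (hl : Reg J (l.map (linForm k))) (hlen : l'.length = l.length)
    (h : hilb (J ⊔ Ideal.ofList (l'.map (linForm k))) ≤
      hilb (J ⊔ Ideal.ofList (l.map (linForm k)))) : Reg J (l'.map (linForm k)) := by
  rw [← hilb_eq_iterate_iff hJ] at hl ⊢
  refine (hilb_le_iterate hJ l').antisymm ?_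
  conv_rhs => rw [hl]
  rw [hlen]
  exact psum_iterate_mono _ h

theorem reg_of_sup_eq {J : Ideal (MvPolynomial (Fin n) k)} (hJ : HomIdeal J)
    {l l' : List (Fin n → k)} (hl : Reg J (l.map (linForm k))) (hlen : l'.length = l.length)
    (h : J ⊔ Ideal.ofList (l'.map (linForm k)) = J ⊔ Ideal.ofList (l.map (linForm k))) :
    Reg J (l'.map (linForm k)) :=
  reg_of_hilb_le hJ hl hlen (by rw [h])

theorem reg_perm {J : Ideal (MvPolynomial (Fin n) k)} (hJ : HomIdeal J)
    {l l' : List (Fin n → k)} (hl : Reg J (l.map (linForm k))) (h : l'.Perm l) :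
    Reg J (l'.map (linForm k)) := by
  refine reg_of_sup_eq hJ hl h.length_eq ?_
  simp only [Ideal.ofList, List.mem_map, h.mem_iff]

end HilbertFunction

section GenericForms

variable {k}

theorem HomIdeal.redIdeal {J : Ideal (MvPolynomial (Fin n) k)} (hJ : HomIdeal J) {e : ℕ}
    (c : Fin e × Fin n → k) : HomIdeal (redIdeal k J c) := by
  have := hJ.sup_ofList (List.ofFn fun (j : Fin e) i => c (j, i))
  simpa [SRWLP.redIdeal, Ideal.ofList, List.map_ofFn, Set.range, Function.comp_def,
    List.mem_ofFn] using this

theorem redIdeal_eq_sup_ofList (J : Ideal (MvPolynomial (Fin n) k)) {e : ℕ}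
    (c : Fin e × Fin n → k) : redIdeal k J c =
      J ⊔ Ideal.ofList ((List.ofFn fun (j : Fin e) i => c (j, i)).map (linForm k)) := by
  simp [redIdeal, Ideal.ofList, List.map_ofFn, Set.range, Function.comp_def,
    List.mem_ofFn]

/-- The dimension of the degree-`m` part of `(J, θ₁, …, θₑ)` is lower semicontinuous in the
coefficients of the linear forms `θⱼ`. -/
theorem exists_finrank_degPart_le {J : Ideal (MvPolynomial (Fin n) k)} (hJ : HomIdeal J) {e : ℕ}
    (c₀ : Fin e × Fin n → k) (m : ℕ) :
    ∃ g : MvPolynomial (Fin e × Fin n) k, eval c₀ g ≠ 0 ∧ ∀ c, eval c g ≠ 0 →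
      Module.finrank k (degPart (redIdeal k J c₀) m) ≤
        Module.finrank k (degPart (redIdeal k J c) m) := by
  classical
  set W := degPart (redIdeal k J c₀) m with hW
  set N := Module.finrank k W
  let b : Module.Basis (Fin N) k W := Module.finBasis k W
  have hb (l : Fin N) : ∃ u ∈ J, ∃ w : Fin e → MvPolynomial (Fin n) k,
      (b l : MvPolynomial (Fin n) k) = u + ∑ j, w j * linForm k fun i => c₀ (j, i) := by
    obtain ⟨u, hu, v, hv, huv⟩ := Submodule.mem_sup.mp (b l).2.2
    obtain ⟨w, rfl⟩ := (Submodule.mem_span_range_iff_exists_fun _).mp hv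
    exact ⟨u, hu, w, huv.symm⟩
  choose u hu w hw using hb
  obtain ⟨φ, hφ⟩ := LinearMap.exists_extend (b.equivFun : W →ₗ[k] Fin N → k)
  let v (c : Fin e × Fin n → k) (l : Fin N) : MvPolynomial (Fin n) k :=
    homogeneousComponent m (u l + ∑ j, w l j * linForm k fun i => c (j, i))
  let P : Matrix (Fin N) (Fin N) (MvPolynomial (Fin e × Fin n) k) := .of fun l l' =>
    C (φ (homogeneousComponent m (u l)) l') +
      ∑ j, ∑ i, X (j, i) * C (φ (homogeneousComponent m (w l j * X i)) l')
  have hP (c) : (eval c).mapMatrix P = .of fun l l' => φ (v c l) l' := by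
    ext l l'
    simp [P, v, linForm, Finset.mul_sum, ← MvPolynomial.smul_eq_C_mul]
  have hmem (c l) : v c l ∈ degPart (redIdeal k J c) m := by
    refine ⟨homogeneousComponent_isHomogeneous _ _, hJ.redIdeal c _ ?_ m⟩
    refine add_mem (Ideal.mem_sup_left (hu l)) (sum_mem fun j _ => Ideal.mul_mem_left _ _ ?_)
    exact Ideal.mem_sup_right (Ideal.subset_span ⟨j, rfl⟩)
  refine ⟨P.det, ?_, fun c hc => ?_⟩
  · have hv (l) : v c₀ l = b l := by
      simp only [v, ← hw]
      exact homogeneousComponent_eq_self (b l).2.1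
    have h1 : (eval c₀).mapMatrix P = 1 := by
      rw [hP]
      ext l l'
      have := congrFun (LinearMap.congr_fun hφ (b l)) l'
      rw [Matrix.of_apply, hv]
      simpa [Finsupp.single_apply, Matrix.one_apply, Pi.single_apply, eq_comm] using this
    rw [RingHom.map_det, h1, Matrix.det_one]
    exact one_ne_zero
  · rw [RingHom.map_det, hP] at hc
    have h1 := Matrix.linearIndependent_rows_iff_isUnit.mpr
      ((Matrix.isUnit_iff_isUnit_det _).mpr hc.isUnit)
    have h2 : LinearIndependent k
        fun l => (⟨v c l, hmem c l⟩ : degPart (redIdeal k J c) m) :=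
      LinearIndependent.of_comp (φ.comp (degPart (redIdeal k J c) m).subtype) h1
    simpa using h2.fintype_card_le_finrank

theorem mem_idealOfVars_pow {a : MvPolynomial (Fin n) k} {m : ℕ} (ha : a.IsHomogeneous m) :
    a ∈ idealOfVars (Fin n) k ^ m := by
  rw [mem_pow_idealOfVars_iff']
  exact fun x hx => ha.coeff_eq_zero hx.ne

theorem homogeneousSubmodule_le_of_le {J : Ideal (MvPolynomial (Fin n) k)} {r m : ℕ} (hrm : r ≤ m)
    (h : homogeneousSubmodule (Fin n) k r ≤ J.restrictScalars k) :
    homogeneousSubmodule (Fin n) k m ≤ J.restrictScalars k := by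
  intro a ha
  have h1 : idealOfVars (Fin n) k ^ r ≤ J := by
    rw [pow_idealOfVars_eq_span, Ideal.span_le]
    rintro _ ⟨x, hx, rfl⟩
    exact h (isHomogeneous_monomial 1 hx)
  exact h1 (Ideal.pow_le_pow_right hrm (mem_idealOfVars_pow ha))

theorem exists_homogeneousSubmodule_le {J : Ideal (MvPolynomial (Fin n) k)} (hJ : HomIdeal J)
    (hdim : ringKrullDim (MvPolynomial (Fin n) k ⧸ J) ≤ 0) :
    ∃ r : ℕ, ∀ m ≥ r, homogeneousSubmodule (Fin n) k m ≤ J.restrictScalars k := by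
  have : Ring.KrullDimLE 0 (MvPolynomial (Fin n) k ⧸ J) := Ring.krullDimLE_iff.mpr hdim
  have : IsArtinianRing (MvPolynomial (Fin n) k ⧸ J) :=
    isArtinianRing_iff_krullDimLE_zero.mpr this
  obtain ⟨r, hr⟩ := IsArtinian.monotone_stabilizes
    (⟨fun m => OrderDual.toDual ((idealOfVars (Fin n) k ^ m).map (Ideal.Quotient.mk J)),
      fun a b hab => Ideal.map_mono (Ideal.pow_le_pow_right hab)⟩ :
      ℕ →o (Ideal (MvPolynomial (Fin n) k ⧸ J))ᵒᵈ)
  refine ⟨r, fun m hm a ha => ?_⟩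
  have h1 : (idealOfVars (Fin n) k ^ m).map (Ideal.Quotient.mk J) =
      (idealOfVars (Fin n) k ^ (m + 1)).map (Ideal.Quotient.mk J) :=
    (hr m hm).symm.trans (hr (m + 1) (by omega))
  have h2 := mem_idealOfVars_pow ha
  have h3 : Ideal.Quotient.mk J a ∈ (idealOfVars (Fin n) k ^ (m + 1)).map (Ideal.Quotient.mk J) :=
    h1 ▸ Ideal.mem_map_of_mem _ h2
  obtain ⟨b, hb, hab⟩ := (Ideal.mem_map_iff_of_surjective _ Ideal.Quotient.mk_surjective).mp h3
  have h4 := hJ _ (Ideal.Quotient.eq.mp hab.symm) m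
  have h5 : homogeneousComponent m b = 0 := by
    refine homogeneousComponent_eq_zero' _ _ fun x hx hxm => ?_
    rw [mem_pow_idealOfVars_iff'] at hb
    exact mem_support_iff.mp hx (hb x (by omega))
  rwa [map_sub, h5, sub_zero, homogeneousComponent_eq_self ha] at h4

/-- `R ⧸ J` has dimension at most `e` and a regular sequence of `e` linear forms. -/
def HasLinearSop (J : Ideal (MvPolynomial (Fin n) k)) (e : ℕ) : Prop :=
  (∃ l : List (Fin n → k), l.length = e ∧ Reg J (l.map (linForm k))) ∧
    ringKrullDim (MvPolynomial (Fin n) k ⧸ J) ≤ e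

theorem Generic.and {τ : Type} {P Q : (τ → k) → Prop} (hP : Generic k τ P) (hQ : Generic k τ Q) :
    Generic k τ fun c => P c ∧ Q c := by
  obtain ⟨f, hf, hf'⟩ := hP
  obtain ⟨g, hg, hg'⟩ := hQ
  refine ⟨f * g, mul_ne_zero hf hg, fun c hc => ?_⟩
  rw [map_mul] at hc
  exact ⟨hf' c (left_ne_zero_of_mul hc), hg' c (right_ne_zero_of_mul hc)⟩

theorem Generic.mono {τ : Type} {P Q : (τ → k) → Prop} (hP : Generic k τ P) (h : ∀ c, P c → Q c) :
    Generic k τ Q :=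
  let ⟨g, hg, hg'⟩ := hP
  ⟨g, hg, fun c hc => h c (hg' c hc)⟩

theorem Generic.all {τ ι : Type} [Finite ι] {P : ι → (τ → k) → Prop}
    (h : ∀ i, Generic k τ (P i)) :
    Generic k τ fun c => ∀ i, P i c := by
  classical
  cases nonempty_fintype ι
  choose g hg hg' using h
  refine ⟨∏ i, g i, Finset.prod_ne_zero_iff.mpr fun i _ => hg i, fun c hc i => hg' i c ?_⟩
  rw [map_prod] at hc
  exact Finset.prod_ne_zero_iff.mp hc i (Finset.mem_univ i)

theorem Generic.comp {τ τ' : Type} {P : (τ → k) → Prop} (h : Generic k τ P) {f : τ → τ'}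
    (hf : Function.Injective f) : Generic k τ' fun c => P (c ∘ f) := by
  obtain ⟨g, hg, hg'⟩ := h
  refine ⟨rename f g, ?_, fun c hc => hg' _ (by rwa [eval_rename] at hc)⟩
  rw [Ne, ← map_zero (rename f)]
  exact (rename_injective f hf).ne hg

theorem Generic.exists [Infinite k] {τ : Type} {P : (τ → k) → Prop} (h : Generic k τ P) :
    ∃ c, P c := by
  obtain ⟨g, hg, hg'⟩ := h
  by_contra! hP
  exact hg (MvPolynomial.funext fun c => by
    rw [map_zero]
    by_contra hc
    exact hP c (hg' c hc))

theorem HasLinearSop.generic {J : Ideal (MvPolynomial (Fin n) k)} (hJ : HomIdeal J) {e : ℕ}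
    (h : HasLinearSop J e) : Generic k (Fin e × Fin n) fun c =>
      Reg J ((List.ofFn fun (j : Fin e) i => c (j, i)).map (linForm k)) := by
  obtain ⟨⟨l, rfl, hl⟩, hdim⟩ := h
  let c₀ : Fin l.length × Fin n → k := fun p => l.get p.1 p.2
  have hc₀ : (List.ofFn fun j i => c₀ (j, i)) = l := List.ofFn_get l
  have hred := redIdeal_eq_sup_ofList J c₀
  rw [hc₀] at hred
  obtain ⟨r, hr⟩ := exists_homogeneousSubmodule_le (hJ.redIdeal c₀) (by
    have h1 := ringKrullDim_add_length_le J _ hl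
    rw [← hred, List.length_map] at h1
    rw [← ENat.WithBot.add_le_add_natCast_right_iff (c := l.length), zero_add]
    exact h1.trans hdim)
  choose g hg₀ hg using fun m => exists_finrank_degPart_le hJ c₀ m
  refine ⟨∏ m ∈ Finset.range (r + 1), g m, fun h0 => ?_, fun c hc => ?_⟩
  · have := congrArg (eval c₀) h0
    rw [map_prod, map_zero] at this
    exact Finset.prod_ne_zero_iff.mpr (fun m _ => hg₀ m) this
  refine reg_of_hilb_le hJ hl (by simp) fun m => ?_
  rw [← redIdeal_eq_sup_ofList, ← hred]
  have hle (i : ℕ) (hi : i ≤ r) : Module.finrank k (degPart (redIdeal k J c₀) i) ≤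
      Module.finrank k (degPart (redIdeal k J c) i) := by
    rw [map_prod] at hc
    exact hg i c (Finset.prod_ne_zero_iff.mp hc i (Finset.mem_range.mpr (by omega)))
  by_cases hm : m ≤ r
  · have := hle m hm
    simp only [hilb]
    omega
  · have h1 (i : ℕ) (hi : r ≤ i) : degPart (redIdeal k J c₀) i = homogeneousSubmodule (Fin n) k i :=
      inf_eq_left.mpr (hr i hi)
    have h2 := hle r le_rfl
    rw [h1 r le_rfl] at h2
    have h3 := Submodule.eq_of_le_of_finrank_le
      (inf_le_left : degPart (redIdeal k J c) r ≤ homogeneousSubmodule (Fin n) k r) h2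
    have h4 : degPart (redIdeal k J c) m = homogeneousSubmodule (Fin n) k m :=
      inf_eq_left.mpr (homogeneousSubmodule_le_of_le (not_le.mp hm).le (inf_eq_left.mp h3))
    rw [hilb, hilb, h1 m (not_le.mp hm).le, h4]

end GenericForms

section MonomialIdeals

variable {k}

/-- The ideal `J : x`. -/
abbrev colonBy {R : Type*} [CommRing R] (J : Ideal R) (x : R) : Ideal R :=
  Submodule.colon J (Ideal.span {x})

theorem mem_colonBy {R : Type*} [CommRing R] {J : Ideal R} {x g : R} :
    g ∈ colonBy J x ↔ x * g ∈ J := by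
  rw [Ideal.mem_colon_span_singleton, mul_comm]

/-- `J` is spanned by monomials, and divisibility of a monomial in `J` by `Xᵢ²` can be
reduced to divisibility by `Xᵢ`. -/
structure SqfreeMonomial (J : Ideal (MvPolynomial (Fin n) k)) : Prop where
  monomial_mem : ∀ a ∈ J, ∀ m ∈ a.support, monomial m 1 ∈ J
  X_mul_mem : ∀ i g, X i * (X i * g) ∈ J → X i * g ∈ J

theorem mem_of_monomial_mem {J : Ideal (MvPolynomial (Fin n) k)} {a : MvPolynomial (Fin n) k}
    (h : ∀ m ∈ a.support, monomial m 1 ∈ J) : a ∈ J := by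
  rw [a.as_sum]
  refine sum_mem fun m hm => ?_
  rw [← mul_one (coeff m a), ← C_mul_monomial]
  exact J.mul_mem_left _ (h m hm)

theorem SqfreeMonomial.homIdeal {J : Ideal (MvPolynomial (Fin n) k)} (hJ : SqfreeMonomial J) :
    HomIdeal J := by
  refine fun a ha d => mem_of_monomial_mem fun m hm => hJ.monomial_mem a ha m ?_
  rw [support_homogeneousComponent] at hm
  exact (Finset.mem_filter.mp hm).1

theorem SqfreeMonomial.colon_X {J : Ideal (MvPolynomial (Fin n) k)} (hJ : SqfreeMonomial J)
    (i : Fin n) : SqfreeMonomial (colonBy J (X i)) where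
  monomial_mem a ha m hm := by
    rw [mem_colonBy] at ha ⊢
    have := hJ.monomial_mem _ ha (Finsupp.single i 1 + m) (by simpa [support_X_mul] using hm)
    rwa [X, monomial_mul, one_mul]
  X_mul_mem j g hg := by
    rw [mem_colonBy] at hg ⊢
    rw [mul_left_comm] at hg ⊢
    refine hJ.X_mul_mem j _ ?_
    rwa [mul_left_comm (X i)] at hg

theorem mem_srIdeal {D : SC n} {a : MvPolynomial (Fin n) k} :
    a ∈ srIdeal k D ↔ ∀ m ∈ a.support, m.support ∉ D.faces := by
  classical
  have h : srIdeal k D = Ideal.span ((fun m => monomial m (1 : k)) ''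
      {m | ∃ s ∉ D.faces, m = ∑ i ∈ s, Finsupp.single i 1}) := by
    rw [srIdeal]
    congr 1
    ext p
    constructor
    · rintro ⟨s, hs, rfl⟩
      exact ⟨_, ⟨s, hs, rfl⟩, by simp [monomial_sum_one, X]⟩
    · rintro ⟨_, ⟨s, hs, rfl⟩, rfl⟩
      exact ⟨s, hs, by simp [monomial_sum_one, X]⟩
  rw [h, mem_ideal_span_monomial_image]
  refine forall₂_congr fun m _ => ?_
  constructor
  · rintro ⟨_, ⟨s, hs, rfl⟩, hle⟩ hm
    refine hs (D.down_closed _ hm s fun i hi => ?_)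
    have := hle i
    rw [Finsupp.mem_support_iff]
    simp [Finsupp.finsetSum_apply, Finsupp.single_apply, hi] at this
    omega
  · intro hm
    refine ⟨_, ⟨m.support, hm, rfl⟩, fun i => ?_⟩
    simp only [Finsupp.finsetSum_apply, Finsupp.single_apply, Finset.sum_ite_eq',
      Finsupp.mem_support_iff]
    split_ifs <;> omega

theorem sqfreeMonomial_srIdeal (D : SC n) : SqfreeMonomial (srIdeal k D) where
  monomial_mem a ha m hm := by
    classical
    rw [mem_srIdeal] at ha ⊢
    intro m' hm'
    rw [support_monomial, if_neg one_ne_zero, Finset.mem_singleton] at hm'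
    exact hm' ▸ ha m hm
  X_mul_mem i g hg := by
    rw [mem_srIdeal] at hg ⊢
    simp only [support_X_mul, Finset.map_map, Finset.mem_map, forall_exists_index, and_imp,
      forall_apply_eq_imp_iff₂] at hg ⊢
    intro m hm
    have := hg m hm
    have e : (Finsupp.single i 1 + m).support =
        (Finsupp.single i 1 + (Finsupp.single i 1 + m)).support := by
      ext j
      simp
    exact fun h => this (e ▸ h)

/-- The substitution `Xᵢ ↦ 0`. -/
def killVar (k : Type) [Field k] (i : Fin n) :
    MvPolynomial (Fin n) k →ₐ[k] MvPolynomial (Fin n) k :=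
  aeval fun j => if j = i then 0 else X j

theorem killVar_X_self (i : Fin n) : killVar k i (X i) = 0 := by simp [killVar]

theorem killVar_linForm {i : Fin n} {v : Fin n → k} (hv : v i = 0) :
    killVar k i (linForm k v) = linForm k v := by
  simp only [linForm, map_sum, map_mul]
  refine Finset.sum_congr rfl fun j _ => ?_
  by_cases h : j = i
  · subst h; simp [hv]
  · simp [killVar, h]

theorem exists_eq_killVar_add (i : Fin n) (g : MvPolynomial (Fin n) k) :
    ∃ b, g = killVar k i g + X i * b := by
  have h : (Ideal.Quotient.mkₐ k (Ideal.span {X i})).comp (killVar k i) =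
      Ideal.Quotient.mkₐ k (Ideal.span {(X i : MvPolynomial (Fin n) k)}) := by
    refine MvPolynomial.algHom_ext fun j => ?_
    by_cases hj : j = i
    · subst hj
      have : Ideal.Quotient.mk (Ideal.span {X j}) (X j : MvPolynomial (Fin n) k) = 0 :=
        Ideal.Quotient.eq_zero_iff_mem.mpr (Ideal.mem_span_singleton_self _)
      simp [killVar, this]
    · simp [killVar, hj]
  have h1 := DFunLike.congr_fun h g
  obtain ⟨b, hb⟩ := Ideal.mem_span_singleton.mp (Ideal.Quotient.eq.mp h1.symm)
  exact ⟨b, by rw [← hb]; exact (add_sub_cancel _ g).symm⟩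

/-- `J` is stable under the substitution `Xᵢ ↦ 0`. -/
def KillStable (i : Fin n) (J : Ideal (MvPolynomial (Fin n) k)) : Prop :=
  ∀ a ∈ J, killVar k i a ∈ J

theorem SqfreeMonomial.killStable {J : Ideal (MvPolynomial (Fin n) k)} (hJ : SqfreeMonomial J)
    (i : Fin n) : KillStable i J := by
  intro a ha
  rw [a.as_sum, map_sum]
  refine sum_mem fun m hm => ?_
  rw [← mul_one (coeff m a), ← C_mul_monomial, map_mul]
  refine J.mul_mem_left _ ?_
  have h := hJ.monomial_mem a ha m hm
  rw [killVar, aeval_monomial, map_one, one_mul]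
  by_cases hi : i ∈ m.support
  · rw [Finsupp.prod, Finset.prod_eq_zero hi]
    · exact J.zero_mem
    · simpa using Finsupp.mem_support_iff.mp hi
  · convert h using 1
    rw [monomial_eq, map_one, one_mul]
    refine Finsupp.prod_congr fun j hj => ?_
    rw [if_neg (by rintro rfl; exact hi hj)]

theorem KillStable.sup_span {i : Fin n} {J : Ideal (MvPolynomial (Fin n) k)} (hJ : KillStable i J)
    {v : Fin n → k} (hv : v i = 0) : KillStable i (J ⊔ Ideal.span {linForm k v}) := by
  intro a ha
  rw [mem_sup_span_singleton_iff] at ha ⊢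
  obtain ⟨b, hb⟩ := ha
  refine ⟨killVar k i b, ?_⟩
  simpa [killVar_linForm hv] using hJ _ hb

theorem KillStable.colon_sup {i : Fin n} {J : Ideal (MvPolynomial (Fin n) k)} (hJ : KillStable i J)
    {v : Fin n → k} (hv : v i = 0) :
    colonBy (J ⊔ Ideal.span {linForm k v}) (X i) =
      colonBy J (X i) ⊔ Ideal.span {linForm k v} := by
  ext g
  simp only [mem_colonBy, mem_sup_span_singleton_iff]
  constructor
  · rintro ⟨b, hb⟩
    obtain ⟨b', hb'⟩ := exists_eq_killVar_add i b
    refine ⟨b', ?_⟩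
    have h := hJ _ hb
    rw [map_sub, map_mul, map_mul, killVar_X_self, killVar_linForm hv, zero_mul, zero_sub] at h
    convert sub_mem hb h using 1
    linear_combination linForm k v * hb'
  · rintro ⟨b, hb⟩
    exact ⟨X i * b, by convert hb using 1; ring⟩

theorem KillStable.reg_colon {i : Fin n} {J : Ideal (MvPolynomial (Fin n) k)} (hJ : KillStable i J)
    {l : List (Fin n → k)} (hl : ∀ v ∈ l, v i = 0) (h : Reg J (l.map (linForm k))) :
    Reg (colonBy J (X i)) (l.map (linForm k)) := by
  induction l generalizing J with
  | nil => trivial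
  | cons v l ih =>
    have hv := hl v (by simp)
    refine ⟨fun g hg => ?_, ?_⟩
    · rw [mem_colonBy, mul_left_comm] at hg
      exact mem_colonBy.mpr (h.1 _ hg)
    · rw [← hJ.colon_sup hv]
      exact ih (hJ.sup_span hv) (fun w hw => hl w (List.mem_cons_of_mem _ hw)) h.2

theorem KillStable.reg_sup {i : Fin n} {J : Ideal (MvPolynomial (Fin n) k)} (hJ : KillStable i J)
    {l : List (Fin n → k)} (hl : ∀ v ∈ l, v i = 0) (h : Reg J (l.map (linForm k))) :
    Reg (J ⊔ Ideal.span {X i}) (l.map (linForm k)) := by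
  induction l generalizing J with
  | nil => trivial
  | cons v l ih =>
    have hv := hl v (by simp)
    refine ⟨fun g hg => ?_, ?_⟩
    · simp only [mem_sup_span_singleton_iff] at hg ⊢
      obtain ⟨b, hb⟩ := hg
      obtain ⟨b', hb'⟩ := exists_eq_killVar_add i g
      refine ⟨b', ?_⟩
      have hb := hJ _ hb
      rw [map_sub, map_mul, map_mul, killVar_X_self, killVar_linForm hv, zero_mul, sub_zero] at hb
      convert h.1 _ hb using 1
      rw [sub_eq_iff_eq_add]
      exact hb'
    · rw [sup_right_comm]
      exact ih (hJ.sup_span hv) (fun w hw => hl w (List.mem_cons_of_mem _ hw)) h.2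

theorem exists_reg_avoiding {J : Ideal (MvPolynomial (Fin n) k)} (hJ : HomIdeal J) {i : Fin n}
    {v : Fin n → k} (hv : v i ≠ 0) {l : List (Fin n → k)}
    (h : Reg J ((v :: l).map (linForm k))) :
    ∃ l' : List (Fin n → k), l'.length = l.length ∧ (∀ w ∈ l', w i = 0) ∧
      Reg J (l'.map (linForm k)) := by
  let f : (Fin n → k) → Fin n → k := fun w => w - (w i / v i) • v
  have hf (w) : linForm k (f w) = linForm k w - C (w i / v i) * linForm k v := by
    have := map_sub (linFormₗ k n) w ((w i / v i) • v)
    rwa [map_smul, MvPolynomial.smul_eq_C_mul] at this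
  refine ⟨l.map f, by simp, by simp [f, hv], ?_⟩
  suffices H : Reg J ((l.map f ++ [v]).map (linForm k)) by
    rw [List.map_append, reg_append] at H
    exact H.1
  refine reg_of_sup_eq hJ h (by simp) (le_antisymm ?_ ?_)
  · refine sup_le le_sup_left (Ideal.span_le.mpr fun p hp => Ideal.mem_sup_right ?_)
    have hvm : linForm k v ∈ Ideal.ofList ((v :: l).map (linForm k)) :=
      Ideal.subset_span (by simp)
    simp only [List.map_append, List.map_map, List.mem_append, List.mem_map, List.map_cons,
      List.map_nil, List.mem_singleton, Set.mem_ofPred_eq, Function.comp_apply] at hp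
    obtain ⟨w, hw, rfl⟩ | rfl := hp
    · rw [hf]
      refine sub_mem (Ideal.subset_span ?_) (Ideal.mul_mem_left _ _ hvm)
      exact List.mem_map_of_mem (List.mem_cons_of_mem _ hw)
    · exact hvm
  · refine sup_le le_sup_left (Ideal.span_le.mpr fun p hp => Ideal.mem_sup_right ?_)
    have hvm : linForm k v ∈ Ideal.ofList ((l.map f ++ [v]).map (linForm k)) :=
      Ideal.subset_span (by simp)
    simp only [List.map_cons, List.mem_cons, List.mem_map, Set.mem_ofPred_eq] at hp
    obtain rfl | ⟨w, hw, rfl⟩ := hp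
    · exact hvm
    · have h1 : linForm k w = linForm k (f w) + C (w i / v i) * linForm k v := by rw [hf]; ring
      rw [h1]
      refine add_mem (Ideal.subset_span ?_) (Ideal.mul_mem_left _ _ hvm)
      exact List.mem_map_of_mem (List.mem_append_left _ (List.mem_map_of_mem hw))

theorem SqfreeMonomial.nzd_X_colon {J : Ideal (MvPolynomial (Fin n) k)} (hJ : SqfreeMonomial J)
    (i : Fin n) (g : MvPolynomial (Fin n) k)
    (hg : X i * g ∈ colonBy J (X i)) :
    g ∈ colonBy J (X i) := by
  rw [mem_colonBy] at hg ⊢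
  exact hJ.X_mul_mem i g hg

theorem ringKrullDim_quotient_le_of_le {R : Type*} [CommRing R] {I J : Ideal R} (h : I ≤ J) :
    ringKrullDim (R ⧸ J) ≤ ringKrullDim (R ⧸ I) :=
  ringKrullDim_le_of_surjective (Ideal.Quotient.factor h) (Ideal.Quotient.factor_surjective h)

theorem SqfreeMonomial.hasLinearSop_colon_X [Infinite k] {J : Ideal (MvPolynomial (Fin n) k)}
    (hJ : SqfreeMonomial J) {e : ℕ} (h : HasLinearSop J (e + 1)) (i : Fin n) :
    HasLinearSop (colonBy J (X i)) (e + 1) ∧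
      HasLinearSop (colonBy J (X i) ⊔ Ideal.span {X i}) e := by
  have hne : Generic k (Fin (e + 1) × Fin n) fun c => c (0, i) ≠ 0 :=
    ⟨X (0, i), X_ne_zero _, fun c hc => by simpa using hc⟩
  obtain ⟨c, hc, hci⟩ := ((h.generic hJ.homIdeal).and hne).exists
  rw [List.ofFn_succ] at hc
  obtain ⟨l, hlen, hl, hreg⟩ := exists_reg_avoiding hJ.homIdeal (v := fun j => c (0, j)) hci hc
  rw [List.length_ofFn] at hlen
  have hreg := (hJ.killStable i).reg_colon hl hreg
  have hsup := ((hJ.colon_X i).killStable i).reg_sup hl hreg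
  have hle : J ≤ colonBy J (X i) := fun g hg =>
    mem_colonBy.mpr (J.mul_mem_left _ hg)
  have hdim := (ringKrullDim_quotient_le_of_le hle).trans h.2
  refine ⟨⟨⟨Pi.single i 1 :: l, by simp [hlen], ?_⟩, hdim⟩, ⟨l, hlen, hsup⟩, ?_⟩
  · rw [List.map_cons, linForm_single]
    exact ⟨hJ.nzd_X_colon i, hsup⟩
  · have h1 := ringKrullDim_add_length_le (colonBy J (X i)) [X i]
      ⟨hJ.nzd_X_colon i, trivial⟩
    rw [Ideal.ofList_singleton] at h1
    have h2 := h1.trans hdim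
    rw [List.length_singleton] at h2
    push_cast at h2
    exact ENat.WithBot.add_le_add_one_right_iff.mp h2

theorem colon_xFace_insert (J : Ideal (MvPolynomial (Fin n) k)) {i : Fin n} {τ : Finset (Fin n)}
    (hi : i ∉ τ) : colonBy J (xFace k (insert i τ)) =
      colonBy (colonBy J (xFace k τ)) (X i) := by
  ext g
  simp only [mem_colonBy, xFace, Finset.prod_insert hi]
  rw [mul_left_comm, mul_assoc]

theorem SqfreeMonomial.colon_xFace [Infinite k] {J : Ideal (MvPolynomial (Fin n) k)}
    (hJ : SqfreeMonomial J) {e : ℕ} (h : HasLinearSop J (e + 1)) (τ : Finset (Fin n)) :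
    SqfreeMonomial (colonBy J (xFace k τ)) ∧
      HasLinearSop (colonBy J (xFace k τ)) (e + 1) := by
  classical
  induction τ using Finset.induction_on with
  | empty =>
    have : colonBy J (xFace k ∅) = J := by
      ext g
      simp [xFace]
    rw [this]
    exact ⟨hJ, h⟩
  | insert i τ hi ih =>
    rw [colon_xFace_insert J hi]
    exact ⟨ih.1.colon_X i, (ih.1.hasLinearSop_colon_X ih.2 i).1⟩

theorem SqfreeMonomial.colon_xFace_colon_X {J : Ideal (MvPolynomial (Fin n) k)}
    (hJ : SqfreeMonomial J) {τ : Finset (Fin n)} {i : Fin n} (hi : i ∈ τ) :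
    colonBy (colonBy J (xFace k τ)) (X i) =
      colonBy J (xFace k τ) := by
  classical
  ext g
  simp only [mem_colonBy]
  refine ⟨fun h => ?_, fun h => ?_⟩
  · have e : xFace k τ = X i * xFace k (τ.erase i) := (Finset.mul_prod_erase _ _ hi).symm
    rw [e, mul_assoc] at h ⊢
    refine hJ.X_mul_mem i _ ?_
    convert h using 1
    ring
  · rw [mul_left_comm]
    exact J.mul_mem_left _ h

theorem isCM.hasLinearSop [Infinite k] {J : Ideal (MvPolynomial (Fin n) k)} {d : ℕ}
    (h : isCM k J d) : HasLinearSop J d := by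
  obtain ⟨hdim, rs, hlen, hrs, hreg⟩ := h
  refine ⟨exists_linear_reg d J rs hlen hrs (reg_of_isWeaklyRegular J rs ?_), hdim.le⟩
  exact (RingTheory.Sequence.isWeaklyRegular_map_algebraMap_iff _ _ _).mp hreg.toIsWeaklyRegular

end MonomialIdeals

section Colon

variable {k}

theorem nzd_sup_take {J : Ideal (MvPolynomial (Fin n) k)} (hJ : HomIdeal J) {v : Fin n → k}
    {l : List (Fin n → k)} (h : Reg J ((v :: l).map (linForm k))) (s : ℕ) :
    ∀ g, linForm k v * g ∈ J ⊔ Ideal.ofList ((l.take s).map (linForm k)) →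
      g ∈ J ⊔ Ideal.ofList ((l.take s).map (linForm k)) := by
  have hp : (l.take s ++ v :: l.drop s).Perm (v :: l) := by
    simpa using List.perm_middle (a := v) (l₁ := l.take s) (l₂ := l.drop s)
  have := reg_perm hJ h hp
  rw [List.map_append, reg_append] at this
  exact this.2.1

theorem nzd_xFace {J : Ideal (MvPolynomial (Fin n) k)} {τ : Finset (Fin n)}
    (h : ∀ i ∈ τ, ∀ g, X i * g ∈ J → g ∈ J) : ∀ g, xFace k τ * g ∈ J → g ∈ J := by
  classical
  induction τ using Finset.induction_on with
  | empty => simp [xFace]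
  | insert i τ hi ih =>
    intro g hg
    rw [xFace, Finset.prod_insert hi, mul_assoc] at hg
    exact ih (fun j hj => h j (Finset.mem_insert_of_mem hj)) g
      (h i (Finset.mem_insert_self i τ) _ hg)

theorem nzd_pow {R : Type*} [CommRing R] {J : Ideal R} {x : R} (h : ∀ g, x * g ∈ J → g ∈ J)
    (s : ℕ) : ∀ g, x ^ s * g ∈ J → g ∈ J := by
  induction s with
  | zero => simp
  | succ s ih =>
    intro g hg
    rw [pow_succ, mul_assoc] at hg
    exact h g (ih _ hg)

theorem colon_eq_of_nzd {R : Type*} [CommRing R] {A B : Ideal R} {x : R} (hAB : A ≤ B)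
    (hx : ∀ g, x * g ∈ B → g ∈ B) (hBA : ∀ g ∈ B, x * g ∈ A) :
    colonBy A x = B := by
  ext g
  rw [mem_colonBy]
  exact ⟨fun h => hx g (hAB h), hBA g⟩

end Colon

section GeneralForms

variable {k}

theorem span_image_eq_ofList {e t : ℕ} (ht : t ≤ e + 1)
    (c : Fin (e + 2) → MvPolynomial (Fin n) k) :
    Ideal.span (c '' {j | 1 ≤ (j : ℕ) ∧ (j : ℕ) < t}) =
      Ideal.ofList ((List.ofFn fun j : Fin e => c j.succ.castSucc).take (t - 1)) := by
  refine congrArg Ideal.span ?_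
  ext p
  simp only [Set.mem_image, Set.mem_ofPred_eq, List.mem_take_iff_getElem, List.length_ofFn,
    List.getElem_ofFn]
  constructor
  · rintro ⟨j, ⟨h1, h2⟩, rfl⟩
    refine ⟨j - 1, by omega, congrArg c (Fin.ext ?_)⟩
    simp only [Fin.val_castSucc, Fin.val_succ]
    omega
  · rintro ⟨j, hj, rfl⟩
    refine ⟨_, ?_, rfl⟩
    simp only [Fin.val_castSucc, Fin.val_succ]
    omega

/-- A general list of linear forms stays regular on `J` when any one of the variables in `τ`, or
one more general form, is placed in front of it. -/
theorem generic_reg_cons [Infinite k] {J : Ideal (MvPolynomial (Fin n) k)} (hJ : SqfreeMonomial J)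
    {e : ℕ} (h : HasLinearSop J (e + 1)) {τ : Finset (Fin n)}
    (hτ : ∀ i ∈ τ, colonBy J (X i) = J) :
    Generic k (Fin (e + 2) × Fin n) fun c =>
      Reg J (((fun i => c (0, i)) :: List.ofFn fun (j : Fin e) i => c (j.succ.castSucc, i)).map
        (linForm k)) ∧
      ∀ i : τ, Reg J ((Pi.single (i : Fin n) 1 ::
        List.ofFn fun (j : Fin e) i => c (j.succ.castSucc, i)).map (linForm k)) := by
  refine Generic.and ?_ (Generic.all fun i => ?_)
  · refine ((h.generic hJ.homIdeal).comp (f := Prod.map Fin.castSucc id)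
      ((Fin.castSucc_injective _).prodMap Function.injective_id)).mono fun c hc => ?_
    rw [List.ofFn_succ] at hc
    exact hc
  · have hX := (hJ.hasLinearSop_colon_X h (i : Fin n)).2
    rw [hτ i i.2] at hX
    refine ((hX.generic (hJ.homIdeal.sup_span (isHomogeneous_X k _))).comp
      (f := Prod.map (fun j : Fin e => j.succ.castSucc) id)
      (((Fin.castSucc_injective _).comp (Fin.succ_injective _)).prodMap
        Function.injective_id)).mono fun c hc => ?_
    rw [List.map_cons, linForm_single]
    refine ⟨fun g hg => ?_, hc⟩
    rwa [← mem_colonBy, hτ i i.2] at hg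

theorem mulIdeal_le {f : MvPolynomial (Fin n) k} {J : Ideal (MvPolynomial (Fin n) k)} :
    mulIdeal k f J ≤ J := by
  rw [mulIdeal, Ideal.span_le]
  rintro _ ⟨g, hg, rfl⟩
  exact J.mul_mem_left f hg

theorem mul_mem_of_mem_sup {R : Type*} [CommRing R] {A J F : Ideal R} {x : R} (hF : F ≤ A)
    (hx : ∀ u ∈ J, x * u ∈ A) : ∀ g ∈ J ⊔ F, x * g ∈ A := by
  intro g hg
  obtain ⟨u, hu, v, hv, rfl⟩ := Submodule.mem_sup.mp hg
  rw [mul_add]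
  exact add_mem (hx u hu) (A.mul_mem_left x (hF hv))

end GeneralForms

/-- **Proposition.** For `1 ≤ t ≤ d` and general linear forms `f₁,…,f_{d+1}`,
`(I, f₁·I_L, f₂, …, f_t) : x_σ = (I, f₁·I_L, f₂, …, f_t) : f₁^{q+1} = (I_L, f₂, …, f_t)`. -/
theorem colon_triple_equality (k : Type) [Field k] [Infinite k]
    (n q d : ℕ) (hq : 1 ≤ q)
    (D : SC n) (hD : gorStar k D)
    (σ : Finset (Fin n)) (hσ : σ ∈ D.faces) (hcard : σ.card = q + 1)
    (hd : d = dimP D) :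
    Generic k (Fin (d + 1) × Fin n) fun c => ∀ t : ℕ, 1 ≤ t → t ≤ d →
      (Submodule.colon
          (srIdeal k D ⊔
            mulIdeal k (linForm k fun i => c (0, i)) (linkIdeal k D σ) ⊔
            Ideal.span ((fun j : Fin (d + 1) => linForm k fun i => c (j, i)) ''
              {j : Fin (d + 1) | 1 ≤ (j : ℕ) ∧ (j : ℕ) < t}))
          (Ideal.span {xFace k σ}) =
        Submodule.colon
          (srIdeal k D ⊔
            mulIdeal k (linForm k fun i => c (0, i)) (linkIdeal k D σ) ⊔
            Ideal.span ((fun j : Fin (d + 1) => linForm k fun i => c (j, i)) ''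
              {j : Fin (d + 1) | 1 ≤ (j : ℕ) ∧ (j : ℕ) < t}))
          (Ideal.span {(linForm k fun i => c (0, i)) ^ (q + 1)})) ∧
      Submodule.colon
          (srIdeal k D ⊔
            mulIdeal k (linForm k fun i => c (0, i)) (linkIdeal k D σ) ⊔
            Ideal.span ((fun j : Fin (d + 1) => linForm k fun i => c (j, i)) ''
              {j : Fin (d + 1) | 1 ≤ (j : ℕ) ∧ (j : ℕ) < t}))
          (Ideal.span {xFace k σ}) =
        linkIdeal k D σ ⊔
          Ideal.span ((fun j : Fin (d + 1) => linForm k fun i => c (j, i)) ''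
            {j : Fin (d + 1) | 1 ≤ (j : ℕ) ∧ (j : ℕ) < t}) := by
  subst hd
  obtain ⟨e, he⟩ : ∃ e, dimP D = e + 1 :=
    Nat.exists_eq_add_one.mpr (by have := Finset.le_sup (f := Finset.card) hσ; unfold dimP; omega)
  have hsop := hD.2.1.1.hasLinearSop
  revert hsop
  generalize dimP D = d at he
  subst he
  intro hsop
  have hI := sqfreeMonomial_srIdeal (k := k) D
  obtain ⟨hJ, hJsop⟩ := hI.colon_xFace hsop σ
  refine (generic_reg_cons hJ hJsop fun i hi => hI.colon_xFace_colon_X hi).mono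
    fun c ⟨hc, hcX⟩ t ht1 ht2 => ?_
  set F := Ideal.span ((fun j : Fin (e + 1 + 1) => linForm k fun i => c (j, i)) ''
    {j : Fin (e + 1 + 1) | 1 ≤ (j : ℕ) ∧ (j : ℕ) < t}) with hF
  have hF' : F = Ideal.ofList
      (((List.ofFn fun (j : Fin e) i => c (j.succ.castSucc, i)).take (t - 1)).map
        (linForm k)) := by
    rw [hF, span_image_eq_ofList ht2, List.map_take, List.map_ofFn]
    rfl
  set f := linForm k fun i => c (0, i)
  have hf := nzd_sup_take hJ.homIdeal hc (t - 1)
  have hX : ∀ i ∈ σ, ∀ g, X i * g ∈ linkIdeal k D σ ⊔ F → g ∈ linkIdeal k D σ ⊔ F := by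
    intro i hi
    have := nzd_sup_take hJ.homIdeal (hcX ⟨i, hi⟩) (t - 1)
    rwa [linForm_single, ← hF'] at this
  rw [← hF'] at hf
  have hAB : srIdeal k D ⊔ mulIdeal k f (linkIdeal k D σ) ⊔ F ≤ linkIdeal k D σ ⊔ F :=
    sup_le_sup_right (sup_le (fun g hg => mem_colonBy.mpr (Ideal.mul_mem_left _ _ hg))
      mulIdeal_le) F
  have h1 := colon_eq_of_nzd hAB (nzd_xFace hX) (mul_mem_of_mem_sup le_sup_right fun u hu =>
    Ideal.mem_sup_left (Ideal.mem_sup_left (mem_colonBy.mp hu)))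
  have h2 := colon_eq_of_nzd hAB (nzd_pow hf (q + 1)) (mul_mem_of_mem_sup le_sup_right
    fun u hu => Ideal.mem_sup_left (Ideal.mem_sup_right (by
      rw [pow_succ', mul_assoc]
      exact Ideal.subset_span ⟨_, Ideal.mul_mem_left _ _ hu, rfl⟩)))
  exact ⟨h1.trans h2.symm, h1⟩

end SRWLP
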